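/- Let M be a generic s×t matrix of linear forms in N variables (i.e., a generic element of ℂ^s ⊗ ℂ^t ⊗ ℂ^N) with N ≥ 3. If s² + t² - N·s·t ≤ 1, then the only pairs (X,Y) ∈ GL(s,ℂ) × GL(t,ℂ) with X·M = M·Y are the trivial ones (X,Y) = (λI, λI), λ ∈ ℂ*. Here 'generic' means: the set of M with this property contains a dense (Zariski open dense) subset of ℂ^s ⊗ ℂ^t ⊗ ℂ^N. -/

import Mathlib

open Matrix

/-- The tensor `M` has only scalar endomorphisms. -/
def BrickT {N s t : ℕ} (M : Fin N → Matrix (Fin s) (Fin t) ℂ) : Prop :=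
  ∀ (X : Matrix (Fin s) (Fin s) ℂ) (Y : Matrix (Fin t) (Fin t) ℂ),
    (∀ v, X * M v = M v * Y) → ∃ c : ℂ, X = c • (1 : Matrix _ _ ℂ) ∧ Y = c • (1 : Matrix _ _ ℂ)

/-- Existence of a brick tensor. -/
def HasT (N s t : ℕ) : Prop := ∃ M : Fin N → Matrix (Fin s) (Fin t) ℂ, BrickT M

/-- Existence of a subspace with scalar stabilizer. -/
def HasS (N s t : ℕ) : Prop := ∃ U : Submodule ℂ (Fin N → Fin s → ℂ),
  Module.finrank ℂ U = t ∧ ∀ X : Matrix (Fin s) (Fin s) ℂ,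
    (∀ u ∈ U, (fun v => X *ᵥ u v) ∈ U) → ∃ c : ℂ, X = c • (1 : Matrix _ _ ℂ)

theorem HasT.symm {N s t : ℕ} (h : HasT N s t) : HasT N t s := by
  obtain ⟨M, hM⟩ := h
  refine ⟨fun v => (M v)ᵀ, fun X Y hXY => ?_⟩
  obtain ⟨c, h1, h2⟩ := hM Yᵀ Xᵀ (fun v => by
    have := congrArg Matrix.transpose (hXY v)
    simpa [Matrix.transpose_mul] using this.symm)
  refine ⟨c, ?_, ?_⟩
  · simpa using congrArg Matrix.transpose h2
  · simpa using congrArg Matrix.transpose h1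

theorem HasS.toT {N s t : ℕ} (hs : 0 < s) (h : HasS N s t) : HasT N s t := by
  obtain ⟨U, hU, hX⟩ := h
  have b := Module.finBasisOfFinrankEq ℂ U hU
  refine ⟨fun v => Matrix.of fun i j => (b j : Fin N → Fin s → ℂ) v i, fun X Y hXY => ?_⟩
  have key : ∀ j, (fun v => X *ᵥ (b j : Fin N → Fin s → ℂ) v) =
      ((∑ k, Y k j • b k : U) : Fin N → Fin s → ℂ) := by
    intro j
    ext v i
    have := congrFun (congrFun (hXY v) i) j
    simp only [Matrix.mul_apply, Matrix.of_apply] at this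
    simp only [Matrix.mulVec, dotProduct, this, Submodule.coe_sum, Submodule.coe_smul,
      Finset.sum_apply, Pi.smul_apply, smul_eq_mul]
    exact Finset.sum_congr rfl fun _ _ => mul_comm _ _
  obtain ⟨c, hc⟩ := hX X (by
    intro u hu
    have h1 : u = ((∑ j, b.repr ⟨u, hu⟩ j • b j : U) : Fin N → Fin s → ℂ) := by
      rw [b.sum_repr]
    have h2 : (fun v => X *ᵥ u v) =
        ∑ j, b.repr ⟨u, hu⟩ j • (fun v => X *ᵥ (b j : Fin N → Fin s → ℂ) v) := by
      ext v i
      have h3 : u v = ∑ j, b.repr ⟨u, hu⟩ j • (b j : Fin N → Fin s → ℂ) v := by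
        have := congrFun h1 v
        simpa only [Submodule.coe_sum, Submodule.coe_smul, Finset.sum_apply, Pi.smul_apply] using this
      conv_lhs => rw [h3]
      simp only [Matrix.mulVec_sum, Matrix.mulVec_smul, Finset.sum_apply, Pi.smul_apply]
    rw [h2]
    refine Submodule.sum_mem _ fun j _ => Submodule.smul_mem _ _ ?_
    rw [key]
    exact Subtype.mem _)
  refine ⟨c, hc, ?_⟩
  ext k j
  have h3 : (∑ k, Y k j • b k : U) = c • b j := by
    apply Subtype.ext
    rw [← key, hc]
    ext v i
    simp [Matrix.smul_mulVec]
  have h4 := congrArg (fun z => b.repr z k) h3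
  simp only [map_sum, map_smul, b.repr_self] at h4
  simp [Finsupp.single_apply] at h4
  simp [h4, Matrix.one_apply, eq_comm]

theorem HasT.toS {N s t : ℕ} (hs : 0 < s) (h : HasT N s t) : HasS N s t := by
  obtain ⟨M, hM⟩ := h
  let f : (Fin t → ℂ) →ₗ[ℂ] (Fin N → Fin s → ℂ) := LinearMap.pi fun v => (M v).mulVecLin
  have hf : ∀ y v, f y v = M v *ᵥ y := fun y v => rfl
  have hinj : Function.Injective f := by
    rw [← LinearMap.ker_eq_bot, LinearMap.ker_eq_bot']
    intro y hy
    by_contra hne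
    obtain ⟨j, hj⟩ := Function.ne_iff.1 hne
    obtain ⟨c, h1, h2⟩ := hM 0 (Matrix.of fun a _ => y a) (by
      intro v
      ext i a
      have := congrFun (congrFun hy v) i
      rw [hf] at this
      simpa [Matrix.mul_apply, Matrix.mulVec, dotProduct] using this.symm)
    have hc : c = 0 := by
      have := congrFun (congrFun h1 ⟨0, hs⟩) ⟨0, hs⟩
      simpa using this.symm
    have := congrFun (congrFun h2 j) j
    simp [hc] at this
    exact hj this
  refine ⟨LinearMap.range f, ?_, ?_⟩
  · rw [LinearMap.finrank_range_of_inj hinj]; simp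
  · intro X hX
    have : ∀ j, ∃ y, f y = (fun v => X *ᵥ f (Pi.single j 1) v) := fun j => hX _ ⟨_, rfl⟩
    choose y hy using this
    obtain ⟨c, h1, -⟩ := hM X (Matrix.of fun k j => y j k) (by
      intro v
      ext i j
      have := congrFun (congrFun (hy j) v) i
      simp only [hf] at this
      rw [Matrix.mulVec_single_one] at this
      simpa [Matrix.mul_apply, Matrix.mulVec, dotProduct] using this.symm)
    exact ⟨c, h1⟩

theorem HasS.dual {N s t : ℕ} (h : HasS N s t) : HasS N s (N * s - t) := by
  obtain ⟨U, hU, hX⟩ := h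
  let B : LinearMap.BilinForm ℂ (Fin N → Fin s → ℂ) :=
    LinearMap.mk₂ ℂ (fun u w => ∑ v, u v ⬝ᵥ w v)
      (by intros; simp [Finset.sum_add_distrib])
      (by intros; simp [Finset.mul_sum])
      (by intros; simp [Finset.sum_add_distrib])
      (by intros; simp [Finset.mul_sum])
  have hB : ∀ u w, B u w = ∑ v, u v ⬝ᵥ w v := fun u w => rfl
  have hsymm : B.IsSymm := ⟨by intro u w; simp [hB, dotProduct_comm]⟩
  have hnd : B.Nondegenerate := by
    have : ∀ u, (∀ w, B u w = 0) → u = 0 := by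
      intro u hu
      ext v i
      have := hu (Pi.single v (Pi.single i 1))
      rw [hB, Finset.sum_eq_single v] at this
      · simpa using this
      · intro b _ hb
        simp [hb]
      · simp
    refine ⟨this, fun u hu => this u fun w => ?_⟩
    rw [← hsymm.eq]; simpa using hu w
  refine ⟨B.orthogonal U, ?_, ?_⟩
  · rw [LinearMap.BilinForm.finrank_orthogonal hnd, hU]; simp [Module.finrank_pi_fintype]
  · intro X h
    have adj : ∀ u w, B u (fun v => Xᵀ *ᵥ w v) = B (fun v => X *ᵥ u v) w := by
      intro u w
      simp only [hB]
      refine Finset.sum_congr rfl fun v _ => ?_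
      rw [Matrix.mulVec_transpose, dotProduct_comm, ← Matrix.dotProduct_mulVec, dotProduct_comm]
    obtain ⟨c, hc⟩ := hX Xᵀ (by
      intro u hu
      rw [← LinearMap.BilinForm.orthogonal_orthogonal hnd hsymm.isRefl U]
      rw [LinearMap.BilinForm.mem_orthogonal_iff]
      intro w hw
      have h1 := h w hw
      rw [LinearMap.BilinForm.mem_orthogonal_iff] at h1
      have h2 : B u (fun v => X *ᵥ w v) = 0 := h1 u hu
      change B w _ = 0
      rw [adj, ← hsymm.eq]; simpa using h2)
    refine ⟨c, ?_⟩
    simpa using congrArg Matrix.transpose hc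

theorem dense_of_hasT {N s t : ℕ} (hs : 0 < s) (h : HasT N s t) :
    Dense {M : Fin N → Matrix (Fin s) (Fin t) ℂ | BrickT M} := by
  obtain ⟨M0, hM0⟩ := h
  let i0 : Fin s := ⟨0, hs⟩
  let φ : (Matrix (Fin s) (Fin s) ℂ × Matrix (Fin t) (Fin t) ℂ) →ₗ[ℂ] ℂ :=
    { toFun := fun p => p.1 i0 i0
      map_add' := by intros; rfl
      map_smul' := by intros; rfl }
  let L : (Fin N → Matrix (Fin s) (Fin t) ℂ) → 
      ((Matrix (Fin s) (Fin s) ℂ × Matrix (Fin t) (Fin t) ℂ) →ₗ[ℂ]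
        (Fin N → Matrix (Fin s) (Fin t) ℂ)) :=
    fun M =>
    { toFun := fun p v => p.1 * M v - M v * p.2
      map_add' := by intro p q; ext1 v; simp [Matrix.add_mul, Matrix.mul_add]; abel
      map_smul' := by intro c p; ext1 v; simp [smul_sub] }
  let R := fun M => (L M).domRestrict (LinearMap.ker φ)
  have hR : ∀ M, Function.Injective (R M) → BrickT M := by
    intro M hM X Y hXY
    let p : LinearMap.ker φ := ⟨(X - X i0 i0 • 1, Y - X i0 i0 • 1), by
      change (X - X i0 i0 • (1 : Matrix (Fin s) (Fin s) ℂ) : Matrix (Fin s) (Fin s) ℂ) i0 i0 = 0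
      simp⟩
    have hp : R M p = 0 := by
      ext1 v
      change (X - X i0 i0 • 1) * M v - M v * (Y - X i0 i0 • 1) = 0
      simp [Matrix.sub_mul, Matrix.mul_sub, hXY v]
    have hp0 : p = 0 := hM (by rw [hp, map_zero])
    have hp1 : (X - X i0 i0 • 1, Y - X i0 i0 • 1) = (0 : Matrix (Fin s) (Fin s) ℂ × Matrix (Fin t) (Fin t) ℂ) := congrArg Subtype.val hp0
    refine ⟨X i0 i0, sub_eq_zero.1 (congrArg Prod.fst hp1), sub_eq_zero.1 (congrArg Prod.snd hp1)⟩
  have hR0 : LinearMap.ker (R M0) = ⊥ := by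
    rw [LinearMap.ker_eq_bot']
    rintro ⟨⟨X, Y⟩, hp⟩ h0
    obtain ⟨c, h1, h2⟩ := hM0 X Y (fun v => sub_eq_zero.1 (congrFun h0 v))
    have hc : c = 0 := by
      have : X i0 i0 = 0 := hp
      simpa [h1] using this
    apply Subtype.ext
    simp [h1, h2, hc]
  obtain ⟨G, hG⟩ := LinearMap.exists_leftInverse_of_injective (R M0) hR0
  intro M
  let T : Module.End ℂ (LinearMap.ker φ) := G ∘ₗ R M
  have hfin : {ε : ℂ | T.HasEigenvalue (-ε)}.Finite := by
    have h1 : Set.Finite {μ : ℂ | T.HasEigenvalue μ} := Module.End.finite_hasEigenvalue T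
    exact h1.preimage (neg_injective.injOn)
  have hd : Dense ({ε : ℂ | T.HasEigenvalue (-ε)}ᶜ) := hfin.countable.dense_compl ℂ
  have hcont : Continuous fun ε : ℂ => M + ε • M0 := by fun_prop
  have := map_mem_closure hcont (hd 0) (t := {M | BrickT M}) (by
    intro ε hε
    apply hR
    rw [← LinearMap.ker_eq_bot, LinearMap.ker_eq_bot']
    intro p hp
    by_contra hne
    apply hε
    refine Module.End.hasEigenvalue_of_hasEigenvector (x := p) ⟨?_, hne⟩
    rw [Module.End.mem_eigenspace_iff]
    have h1 : R (M + ε • M0) p = R M p + ε • R M0 p := by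
      ext1 v
      change p.1.1 * (M v + ε • M0 v) - (M v + ε • M0 v) * p.1.2 =
        (p.1.1 * M v - M v * p.1.2) + ε • (p.1.1 * M0 v - M0 v * p.1.2)
      simp [Matrix.add_mul, Matrix.mul_add, smul_sub]
      abel
    have h2 : G (R M0 p) = p := LinearMap.congr_fun hG p
    have h3 := congrArg G (h1.symm.trans hp)
    rw [map_add, map_smul, h2, map_zero] at h3
    change G (R M p) = _
    rw [neg_smul]
    exact eq_neg_of_add_eq_zero_left h3)
  simpa using this

/-- The auxiliary linear map used for the explicit construction. -/
noncomputable def auxF (N s r m : ℕ) : ((Fin s → ℂ) × (Fin r → ℂ) × (Fin m → Fin s → ℂ)) →ₗ[ℂ]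
    (Fin N → Fin s → ℂ) where
  toFun p := fun v i =>
    if v.1 = 0 then p.1 i else if v.1 = 1 then (i.1 : ℂ) * p.1 i
    else if v.1 = 2 then (∑ j, p.1 j) + (if hi : i.1 < r then p.2.1 ⟨i, hi⟩ else ∑ a, p.2.1 a)
    else if hv : v.1 - 3 < m then p.2.2 ⟨v.1 - 3, hv⟩ i else 0
  map_add' p q := by
    ext v i
    simp only [Prod.fst_add, Prod.snd_add, Pi.add_apply, Finset.sum_add_distrib]
    split_ifs <;> ring
  map_smul' c p := by
    ext v i
    simp only [Prod.smul_fst, Prod.smul_snd, Pi.smul_apply, smul_eq_mul, ← Finset.mul_sum,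
      RingHom.id_apply]
    split_ifs <;> ring

theorem hasS_direct {N s r m : ℕ} (hr : r < s) (hm : m + 3 ≤ N) :
    HasS N s (s + (r + m * s)) := by
  let f := auxF N s r m
  have f0 : ∀ p i, f p ⟨0, by omega⟩ i = p.1 i := by intro p i; simp [f, auxF]
  have f1 : ∀ p i, f p ⟨1, by omega⟩ i = (i.1 : ℂ) * p.1 i := by intro p i; simp [f, auxF]
  have f2 : ∀ p i, f p ⟨2, by omega⟩ i = (∑ j, p.1 j) +
      (if hi : i.1 < r then p.2.1 ⟨i, hi⟩ else ∑ a, p.2.1 a) := by intro p i; simp [f, auxF]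
  have f3 : ∀ p i (a : Fin m), f p ⟨a.1 + 3, by omega⟩ i = p.2.2 a i := by
    intro p i a; simp [f, auxF]
  have hinj : Function.Injective f := by
    rw [← LinearMap.ker_eq_bot, LinearMap.ker_eq_bot']
    rintro ⟨w, k, g⟩ hp
    have hw : w = 0 := by
      ext i; have := f0 (w, k, g) i; rw [hp] at this; simpa using this.symm
    have hk : k = 0 := by
      ext a; have := f2 (w, k, g) ⟨a.1, by omega⟩; rw [hp] at this
      simpa [hw] using this.symm
    have hg : g = 0 := by
      ext a i; have := f3 (w, k, g) i a; rw [hp] at this; simpa using this.symm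
    simp [hw, hk, hg]
  refine ⟨LinearMap.range f, ?_, ?_⟩
  · rw [LinearMap.finrank_range_of_inj hinj]; simp [Module.finrank_pi_fintype]
  · intro X hX
    have hmem : ∀ p, ∃ q, f q = (fun v => X *ᵥ f p v) := fun p => hX _ ⟨_, rfl⟩
    have g0 : ∀ w, f (w, 0, 0) ⟨0, by omega⟩ = w := by intro w; ext i; exact f0 _ _
    have hdiag : ∀ i j, i ≠ j → X i j = 0 := by
      intro i j hij
      obtain ⟨q, hq⟩ := hmem (Pi.single j 1, 0, 0)
      have e0 := congrFun (congrFun hq ⟨0, by omega⟩) i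
      have e1 := congrFun (congrFun hq ⟨1, by omega⟩) i
      rw [f0] at e0
      rw [f1] at e1
      simp only [Matrix.mulVec, dotProduct, f0, f1, Pi.single_apply] at e0 e1
      simp at e0 e1
      rw [e0] at e1
      have : ((i.1 : ℂ) - j.1) * X i j = 0 := by rw [sub_mul, e1]; ring
      rcases mul_eq_zero.1 this with h | h
      · exact absurd (Fin.ext (by exact_mod_cast sub_eq_zero.1 h)) hij
      · exact h
    have hmv : ∀ w i, (X *ᵥ w) i = X i i * w i := by
      intro w i
      simp only [Matrix.mulVec, dotProduct]
      exact Finset.sum_eq_single i (fun j _ hj => by rw [hdiag i j hj.symm, zero_mul]) (by simp)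
    have hall : ∀ i j, X i i = X j j := by
      rcases Nat.eq_zero_or_pos r with h0 | h0
      · subst h0
        intro i j
        obtain ⟨q, hq⟩ := hmem (Pi.single j 1, 0, 0)
        have e0 : ∀ l, q.1 l = X l l * (Pi.single j 1 : Fin s → ℂ) l := by
          intro l
          have e0 := congrFun (congrFun hq ⟨0, by omega⟩) l
          rwa [f0, hmv, f0] at e0
        have e2 := congrFun (congrFun hq ⟨2, by omega⟩) i
        rw [f2, hmv, f2] at e2
        simp [e0, Pi.single_apply] at e2
        exact e2.symm
      · have hlast : ∀ (a : Fin r) (j : Fin s), r ≤ j.1 → 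
            X j j = X ⟨a.1, by omega⟩ ⟨a.1, by omega⟩ := by
          intro a j hj
          obtain ⟨q, hq⟩ := hmem (0, Pi.single a 1, 0)
          have e0 : ∀ l, q.1 l = 0 := by
            intro l
            have e0 := congrFun (congrFun hq ⟨0, by omega⟩) l
            rw [f0, hmv, f0] at e0
            simpa using e0
          have e2 : ∀ b : Fin r, q.2.1 b = X ⟨b.1, by omega⟩ ⟨b.1, by omega⟩ *
              (Pi.single a 1 : Fin r → ℂ) b := by
            intro b
            have e2 := congrFun (congrFun hq ⟨2, by omega⟩) ⟨b.1, by omega⟩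
            rw [f2, hmv, f2] at e2
            simpa [e0] using e2
          have e3 := congrFun (congrFun hq ⟨2, by omega⟩) j
          rw [f2, hmv, f2] at e3
          simp [e0, e2, Pi.single_apply, not_lt.2 hj] at e3
          exact e3.symm
        have hl : ∀ i : Fin s, X i i = X ⟨s - 1, by omega⟩ ⟨s - 1, by omega⟩ := by
          intro i
          by_cases hi : i.1 < r
          · exact (hlast ⟨i.1, hi⟩ ⟨s - 1, by omega⟩ (by simp; omega)).symm
          · rw [hlast ⟨0, h0⟩ i (by omega), hlast ⟨0, h0⟩ ⟨s - 1, by omega⟩ (by simp; omega)]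
        intro i j
        rw [hl i, hl j]
    refine ⟨X ⟨0, by omega⟩ ⟨0, by omega⟩, ?_⟩
    ext i j
    by_cases hij : i = j
    · subst hij
      simpa using hall _ _
    · simp [hdiag i j hij, hij]

theorem hasT_main (N : ℕ) (hN : 3 ≤ N) : ∀ n s t : ℕ, s + t ≤ n → 0 < s → 0 < t →
    (s : ℤ)^2 + (t : ℤ)^2 - N * s * t ≤ 1 → HasT N s t := by
  intro n
  induction n with
  | zero => intro s t h1 h2 h3; omega
  | succ n ih =>
    have key : ∀ s t : ℕ, s ≤ t → s + t ≤ n + 1 → 0 < s → 0 < t →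
        (s : ℤ)^2 + (t : ℤ)^2 - N * s * t ≤ 1 → HasT N s t := by
      intro s t hst hn hs ht h
      have hN' : (3 : ℤ) ≤ N := by exact_mod_cast hN
      have hs' : (1 : ℤ) ≤ s := by exact_mod_cast hs
      have ht' : (1 : ℤ) ≤ t := by exact_mod_cast ht
      rcases lt_or_ge t ((N - 1) * s) with hlt | hge
      · have hdm := Nat.div_add_mod t s
        have hm1 : 1 ≤ t / s := (Nat.one_le_div_iff hs).2 hst
        have hm2 : t / s < N - 1 := (Nat.div_lt_iff_lt_mul hs).2 hlt
        have hrs := Nat.mod_lt t hs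
        obtain ⟨m, hm⟩ := Nat.exists_eq_add_of_le hm1
        have hS := hasS_direct (N := N) (s := s) (r := t % s) (m := m) hrs (by omega)
        have : s + (t % s + m * s) = t := by
          rw [hm] at hdm
          conv_rhs => rw [← hdm]
          ring
        rw [this] at hS
        exact hS.toT hs
      · rcases lt_or_ge t (N * s) with hlt2 | hge2
        · have hle : N * s - t ≤ s := by
            have : (N - 1) * s + s = N * s := by
              obtain ⟨k, rfl⟩ : ∃ k, N = k + 1 := ⟨N - 1, by omega⟩
              simp; ring
            omega
          have hlts : s < t := by
            have : 2 * s ≤ (N - 1) * s := Nat.mul_le_mul_right s (by omega)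
            omega
          have hT := ih s (N * s - t) (by omega) hs (by omega) (by
            rw [Nat.cast_sub hlt2.le]; push_cast
            nlinarith)
          have := (hT.toS hs).dual
          rw [Nat.sub_sub_self hlt2.le] at this
          exact this.toT hs
        · have hge3 : (N : ℤ) * s ≤ t := by exact_mod_cast hge2
          have h1 : (0 : ℤ) ≤ t * (t - N * s) := mul_nonneg (by omega) (by omega)
          have hs1 : (s : ℤ) = 1 := by nlinarith
          have ht1 : (t : ℤ) = N * s := by nlinarith
          have hs1 : s = 1 := by exact_mod_cast hs1
          have ht1 : t = N * s := by exact_mod_cast ht1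
          subst hs1
          subst ht1
          refine HasS.toT hs ⟨⊤, by simp [Module.finrank_pi_fintype], fun X _ => ⟨X 0 0, ?_⟩⟩
          ext i j
          fin_cases i; fin_cases j; simp
    intro s t hn hs ht h
    rcases le_total s t with hst | hst
    · exact key s t hst hn hs ht h
    · exact (key t s hst (by omega) ht hs (by linarith)).symm
 
theorem stmt10 (N s t : ℕ) (hN : 3 ≤ N) (hs : 0 < s) (ht : 0 < t)
    (h : (s : ℤ)^2 + (t : ℤ)^2 - N * s * t ≤ 1) :
    Dense {M : Fin N → Matrix (Fin s) (Fin t) ℂ |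
      ∀ (X : Matrix.GeneralLinearGroup (Fin s) ℂ)
        (Y : Matrix.GeneralLinearGroup (Fin t) ℂ),
        (∀ v : Fin N,
          (X : Matrix (Fin s) (Fin s) ℂ) * M v = M v * (Y : Matrix (Fin t) (Fin t) ℂ)) →
        ∃ c : ℂˣ, (X : Matrix (Fin s) (Fin s) ℂ) = (c : ℂ) • (1 : Matrix (Fin s) (Fin s) ℂ) ∧
          (Y : Matrix (Fin t) (Fin t) ℂ) = (c : ℂ) • (1 : Matrix (Fin t) (Fin t) ℂ)} := by
  refine (dense_of_hasT hs (hasT_main N hN _ s t le_rfl hs ht h)).mono ?_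
  intro M hM X Y hXY
  obtain ⟨c, h1, h2⟩ := hM X Y hXY
  have hc : c ≠ 0 := by
    rintro rfl
    have : Nonempty (Fin s) := ⟨⟨0, hs⟩⟩
    rw [zero_smul] at h1
    exact X.ne_zero h1
  exact ⟨Units.mk0 c hc, h1, h2⟩
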